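/- Every real number x with |x| ≤ 1 has a signed digit representation: there exists a sequence d : ℕ → ℤ such that d n ∈ {-1, 0, 1} for every n and x = ∑' n, (d n : ℝ) / 2^(n+1). (This is the classical content of the paper's main case study, Theorem 6.3, which proves G ⊆ S₂, i.e. that every real in [-1,1] admitting an infinite Gray code admits a signed digit representation.) -/

import Mathlib

/-- A leading signed binary digit of `y ∈ [-1, 1]`. -/
noncomputable def leadingDigit (y : ℝ) : ℤ := if 0 ≤ y then 1 else -1

/-- The remainder, rescaled to `[-1, 1]`, after extracting `n` signed digits from `x`. -/
noncomputable def signedRemainder (x : ℝ) : ℕ → ℝ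
  | 0 => x
  | n + 1 => 2 * signedRemainder x n - leadingDigit (signedRemainder x n)

lemma abs_leadingDigit (y : ℝ) : |(leadingDigit y : ℝ)| = 1 := by
  unfold leadingDigit
  split_ifs <;> simp

lemma abs_two_mul_sub_leadingDigit_le {y : ℝ} (hy : |y| ≤ 1) :
    |2 * y - leadingDigit y| ≤ 1 := by
  rw [abs_le] at hy ⊢
  unfold leadingDigit
  split_ifs <;> push_cast <;> constructor <;> linarith

lemma abs_signedRemainder_le {x : ℝ} (hx : |x| ≤ 1) (n : ℕ) : |signedRemainder x n| ≤ 1 := by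
  induction n with
  | zero => exact hx
  | succ n ih => exact abs_two_mul_sub_leadingDigit_le ih

lemma sum_leadingDigit_signedRemainder (x : ℝ) (n : ℕ) :
    ∑ i ∈ Finset.range n, (leadingDigit (signedRemainder x i) : ℝ) / 2 ^ (i + 1) =
      x - signedRemainder x n / 2 ^ n := by
  induction n with
  | zero => simp [signedRemainder]
  | succ n ih =>
    rw [Finset.sum_range_succ, ih, signedRemainder]
    field_simp
    ring

lemma hasSum_leadingDigit_signedRemainder {x : ℝ} (hx : |x| ≤ 1) :
    HasSum (fun n : ℕ ↦ (leadingDigit (signedRemainder x n) : ℝ) / 2 ^ (n + 1)) x := by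
  have hgeom : Summable fun n : ℕ ↦ (1 / 2 : ℝ) ^ n := summable_geometric_two
  have hsum : Summable fun n : ℕ ↦
      (leadingDigit (signedRemainder x n) : ℝ) / 2 ^ (n + 1) := by
    refine Summable.of_norm_bounded ((summable_nat_add_iff 1).2 hgeom) fun n ↦ ?_
    simp [abs_leadingDigit]
  rw [hsum.hasSum_iff_tendsto_nat]
  simp_rw [sum_leadingDigit_signedRemainder]
  have hrem : Filter.Tendsto (fun n ↦ signedRemainder x n / 2 ^ n) Filter.atTop (nhds 0) := by
    refine squeeze_zero_norm (fun n ↦ ?_) hgeom.tendsto_atTop_zero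
    rw [norm_div, norm_pow, Real.norm_eq_abs, Real.norm_two, one_div_pow]
    gcongr
    exact abs_signedRemainder_le hx n
  simpa using hrem.const_sub x

theorem signed_digit_representation_exists (x : ℝ) (hx : |x| ≤ 1) :
    ∃ d : ℕ → ℤ, (∀ n, d n ∈ ({-1, 0, 1} : Set ℤ)) ∧
      x = ∑' n : ℕ, (d n : ℝ) / 2 ^ (n + 1) := by
  refine ⟨fun n ↦ leadingDigit (signedRemainder x n), fun n ↦ ?_,
    (hasSum_leadingDigit_signedRemainder hx).tsum_eq.symm⟩
  dsimp only [leadingDigit]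
  split_ifs <;> simp
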